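/- Let S be an S-tree. Then a vertex v of S is left unsaturated by some maximum matching of S if and only if v ∈ Supp(S); that is, the Edmonds–Gallai set EG(S) of vertices missed by some maximum matching equals Supp(S). -/

import Mathlib

open scoped Classical

namespace NullDecomp

variable {V : Type*}

/-- The null space of the real adjacency matrix of a graph. -/
def nullSpace [Fintype V] (G : SimpleGraph V) : Set (V → ℝ) :=
  {x | Matrix.mulVec (G.adjMatrix ℝ) x = 0}

/-- The support of the null space: vertices with a nonzero entry in some null vector. -/
def supportSet [Fintype V] (G : SimpleGraph V) : Set V :=
  {v | ∃ x ∈ nullSpace G, x v ≠ 0}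

/-- The (open) neighborhood of a set of vertices. -/
def nbhdSet (G : SimpleGraph V) (A : Set V) : Set V :=
  {v | ∃ u ∈ A, G.Adj u v}

/-- The closed neighborhood of a set of vertices. -/
def closedNbhd (G : SimpleGraph V) (A : Set V) : Set V :=
  A ∪ nbhdSet G A

/-- The core of a graph: the neighborhood of the support of the null space. -/
def coreSet [Fintype V] (G : SimpleGraph V) : Set V :=
  nbhdSet G (supportSet G)

/-- A tree is an S-tree if the closed neighborhood of its support is everything. -/
def IsSTree [Fintype V] (G : SimpleGraph V) : Prop :=
  G.IsTree ∧ closedNbhd G (supportSet G) = Set.univ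

/-- A matching: a set of edges of `G`, pairwise disjoint. -/
def IsMatchingSet (G : SimpleGraph V) (M : Finset (Sym2 V)) : Prop :=
  (↑M : Set (Sym2 V)) ⊆ G.edgeSet ∧
    ∀ e ∈ M, ∀ f ∈ M, e ≠ f → ∀ v : V, v ∈ e → v ∉ f

/-- A maximum matching. -/
def IsMaxMatching [Fintype V] (G : SimpleGraph V) (M : Finset (Sym2 V)) : Prop :=
  IsMatchingSet G M ∧ ∀ M' : Finset (Sym2 V), IsMatchingSet G M' → M'.card ≤ M.card

/-- The matching number. -/
noncomputable def matchingNumber [Fintype V] (G : SimpleGraph V) : ℕ :=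
  sSup {n | ∃ M : Finset (Sym2 V), IsMatchingSet G M ∧ M.card = n}

/-- An independent set of vertices. -/
def IsIndep (G : SimpleGraph V) (A : Set V) : Prop :=
  ∀ u ∈ A, ∀ w ∈ A, ¬ G.Adj u w

/-- The independence number. -/
noncomputable def indepNumber [Fintype V] (G : SimpleGraph V) : ℕ :=
  sSup {n | ∃ A : Set V, IsIndep G A ∧ A.ncard = n}

/-- A vertex cover. -/
def IsVertexCover (G : SimpleGraph V) (Cs : Set V) : Prop :=
  ∀ e ∈ G.edgeSet, ∃ v ∈ Cs, v ∈ e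

/-- The vertex cover number. -/
noncomputable def coverNumber [Fintype V] (G : SimpleGraph V) : ℕ :=
  sInf {n | ∃ Cs : Set V, IsVertexCover G Cs ∧ Cs.ncard = n}

/-- The nullity of a graph: dimension of the kernel of its adjacency matrix. -/
noncomputable def nullity [Fintype V] (G : SimpleGraph V) : ℕ :=
  Module.finrank ℝ (LinearMap.ker (Matrix.mulVecLin (G.adjMatrix ℝ)))

/-- The number of maximum matchings of a graph. -/
noncomputable def numMaxMatchings [Fintype V] (G : SimpleGraph V) : ℕ :=
  Set.ncard {M : Finset (Sym2 V) | IsMaxMatching G M}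

/-- `C` is (the vertex set of) a connected component of the subgraph of `T`
induced by the closed neighborhood of the support of `T`. -/
def IsSComponent [Fintype V] (T : SimpleGraph V) (C : Set V) : Prop :=
  ∃ c : (T.induce (closedNbhd T (supportSet T))).ConnectedComponent,
    C = Subtype.val '' c.supp

/-- `C` is (the vertex set of) a connected component of the subgraph of `T`
induced by the complement of the closed neighborhood of the support of `T`. -/
def IsNComponent [Fintype V] (T : SimpleGraph V) (C : Set V) : Prop :=
  ∃ c : (T.induce ((closedNbhd T (supportSet T))ᶜ)).ConnectedComponent,
    C = Subtype.val '' c.supp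

/-- The zero-extension to `ℝ^V` of the null space of the subgraph of `T` induced by `C`:
vectors vanishing outside `C` whose restriction to `C` is a null vector of `T.induce C`. -/
noncomputable def extNull [Fintype V] (T : SimpleGraph V) (C : Set V) : Submodule ℝ (V → ℝ) :=
  LinearMap.ker ((Matrix.mulVecLin ((T.induce C).adjMatrix ℝ)).comp
      (LinearMap.funLeft ℝ ℝ (Subtype.val : ↥C → V))) ⊓
  LinearMap.ker (LinearMap.funLeft ℝ ℝ (Subtype.val : ↥(Cᶜ) → V))

theorem sum_neighbors_eq_zero [Fintype V] {G : SimpleGraph V} {x : V → ℝ}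
    (hx : x ∈ nullSpace G) (u : V) : ∑ w, (if G.Adj u w then x w else 0) = 0 := by
  have h : (G.adjMatrix ℝ).mulVec x = 0 := hx
  simpa [Matrix.mulVec, dotProduct, SimpleGraph.adjMatrix_apply] using congrFun h u

theorem mem_nullSpace_of_sum_neighbors [Fintype V] {G : SimpleGraph V} {x : V → ℝ}
    (hx : ∀ u, ∑ w, (if G.Adj u w then x w else 0) = 0) : x ∈ nullSpace G := by
  change (G.adjMatrix ℝ).mulVec x = 0
  ext u
  simpa [Matrix.mulVec, dotProduct, SimpleGraph.adjMatrix_apply] using hx u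

/-- A bridge `uw` imposes a proportionality relation between the entries at `u` and `w` of any two
null vectors. -/
theorem mul_eq_mul_of_isBridge [Fintype V] {G : SimpleGraph V} {u w : V} (hadj : G.Adj u w)
    (hb : G.IsBridge s(u, w)) {x y : V → ℝ} (hx : x ∈ nullSpace G) (hy : y ∈ nullSpace G) :
    x u * y w = x w * y u := by
  rw [SimpleGraph.isBridge_iff] at hb
  set R : V → Prop := (G.deleteEdges {s(u, w)}).Reachable u
  have hRu : R u := SimpleGraph.Reachable.refl u
  have hstep : ∀ a b, G.Adj a b → R a → ¬ R b → a = u ∧ b = w := by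
    intro a b hab ha hnb
    by_contra hne
    have hne' : ¬ (a = w ∧ b = u) := fun h => hb (h.1 ▸ ha)
    refine hnb (ha.trans (SimpleGraph.Adj.reachable ?_))
    rw [SimpleGraph.deleteEdges_adj]
    refine ⟨hab, ?_⟩
    simp only [Set.mem_singleton_iff, Sym2.eq_iff]
    tauto
  -- Evaluate the sum of `x a * y b` over adjacent pairs with `a` on the side of `u` in two ways.
  have hzero₁ : ∑ a, ∑ b, (if R a ∧ G.Adj a b then x a * y b else 0) = 0 := by
    refine Finset.sum_eq_zero fun a _ => ?_
    have h := congrArg (fun t => (if R a then x a else 0) * t) (sum_neighbors_eq_zero hy a)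
    simp only [Finset.mul_sum, mul_zero] at h
    refine Eq.trans (Finset.sum_congr rfl fun b _ => ?_) h
    by_cases h₁ : R a <;> by_cases h₂ : G.Adj a b <;> simp [h₁, h₂]
  have hzero₂ : ∑ a, ∑ b, (if R b ∧ G.Adj a b then x a * y b else 0) = 0 := by
    rw [Finset.sum_comm]
    refine Finset.sum_eq_zero fun b _ => ?_
    have h := congrArg (fun t => (if R b then y b else 0) * t) (sum_neighbors_eq_zero hx b)
    simp only [Finset.mul_sum, mul_zero] at h
    refine Eq.trans (Finset.sum_congr rfl fun a _ => ?_) h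
    by_cases h₁ : R b <;> by_cases h₂ : G.Adj a b <;>
      simp [h₁, h₂, G.adj_comm b a, mul_comm]
  have hdiff : ∑ a, ∑ b, ((if R a ∧ G.Adj a b then x a * y b else 0) -
      (if R b ∧ G.Adj a b then x a * y b else 0)) =
      ∑ a, ∑ b, ((if a = u then (if b = w then x u * y w else 0) else 0) -
        (if a = w then (if b = u then x w * y u else 0) else 0)) := by
    refine Finset.sum_congr rfl fun a _ => Finset.sum_congr rfl fun b _ => ?_
    have huw : u ≠ w := hadj.ne
    by_cases hab : G.Adj a b
    · by_cases ha : R a <;> by_cases hbb : R b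
      · have h₁ : a ≠ w := fun h => hb (h ▸ ha)
        have h₂ : b ≠ w := fun h => hb (h ▸ hbb)
        simp [ha, hbb, h₁, h₂]
      · obtain ⟨rfl, rfl⟩ := hstep a b hab ha hbb
        simp [ha, hbb, hab, huw]
      · obtain ⟨rfl, rfl⟩ := hstep b a hab.symm hbb ha
        simp [ha, hbb, hab, huw.symm]
      · have h₁ : a ≠ u := fun h => ha (h ▸ hRu)
        have h₂ : b ≠ u := fun h => hbb (h ▸ hRu)
        simp [ha, hbb, h₁, h₂]
    · have h₁ : ¬ (a = u ∧ b = w) := by rintro ⟨rfl, rfl⟩; exact hab hadj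
      have h₂ : ¬ (a = w ∧ b = u) := by rintro ⟨rfl, rfl⟩; exact hab hadj.symm
      simp only [hab, and_false, if_false, sub_zero, ← ite_and, h₁, h₂]
  simp only [Finset.sum_sub_distrib, hzero₁, hzero₂, Finset.sum_ite_eq', Finset.mem_univ,
    if_true, Finset.sum_ite_irrel, Finset.sum_const_zero, sub_zero] at hdiff
  linarith

/-- The support of an acyclic graph is independent. -/
theorem isIndep_supportSet [Fintype V] {G : SimpleGraph V} (hG : G.IsAcyclic) :
    IsIndep G (supportSet G) := by
  rintro u ⟨x, hx, hxu⟩ w ⟨y, hy, hyw⟩ hadj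
  have hb := SimpleGraph.isAcyclic_iff_forall_isBridge.1 hG ((SimpleGraph.mem_edgeSet G).2 hadj)
  let c := hG.coloringTwo
  let σ : V → ℝ := fun a => if c a = 0 then 1 else -1
  have hσ : ∀ a b, G.Adj a b → σ b = -σ a := by
    intro a b hab
    have := c.valid hab
    simp only [σ]
    split_ifs with h₁ h₂ <;> first | (exfalso; omega) | norm_num
  have hσx : (fun a => σ a * x a) ∈ nullSpace G := by
    refine mem_nullSpace_of_sum_neighbors fun a => ?_
    have h := congrArg (fun t => -σ a * t) (sum_neighbors_eq_zero hx a)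
    simp only [Finset.mul_sum, mul_zero] at h
    refine Eq.trans (Finset.sum_congr rfl fun b _ => ?_) h
    split_ifs with hab
    · rw [hσ a b hab]
    · simp
  have h₁ := mul_eq_mul_of_isBridge hadj hb hx hy
  have h₂ := mul_eq_mul_of_isBridge hadj hb hσx hy
  have hσu : σ u ≠ 0 := by simp only [σ]; split_ifs <;> norm_num
  simp only [hσ u w hadj] at h₂
  have h₃ : σ u * (x u * y w) = 0 := by linear_combination h₂ / 2 + σ u * h₁ / 2
  exact mul_ne_zero hσu (mul_ne_zero hxu hyw) h₃

/-- A neighbor of a supported vertex is adjacent to another supported vertex. -/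
theorem exists_ne_adj_mem_supportSet [Fintype V] {G : SimpleGraph V} {s c : V}
    (hs : s ∈ supportSet G) (hadj : G.Adj c s) : ∃ t ∈ supportSet G, s ≠ t ∧ G.Adj c t := by
  obtain ⟨x, hx, hxs⟩ := hs
  by_contra! h
  have hsum := sum_neighbors_eq_zero hx c
  rw [Finset.sum_eq_single s] at hsum
  · exact hxs (by simpa [hadj] using hsum)
  · intro t _ hts
    split_ifs with hct
    · by_contra hxt
      exact h t ⟨x, hx, hxt⟩ hts.symm hct
    · rfl
  · simp

theorem card_edgeSet_lt_of_isAcyclic {W : Type*} [Fintype W] [Nonempty W] {G : SimpleGraph W}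
    (hG : G.IsAcyclic) : Fintype.card G.edgeSet < Fintype.card W := by
  obtain ⟨T, hGT, -, hT⟩ :=
    (SimpleGraph.connected_top (V := W)).exists_isTree_le_of_le_of_isAcyclic le_top hG
  rw [← hT.card_edgeFinset, ← SimpleGraph.edgeFinset_card, Nat.lt_succ_iff]
  exact Finset.card_le_card (SimpleGraph.edgeFinset_mono hGT)

/-- In an acyclic graph, if each vertex of `C` has two neighbors in a set `D` disjoint from `C`,
then `C` is smaller than `D`. -/
theorem card_lt_card_of_two_neighbors {G : SimpleGraph V} (hG : G.IsAcyclic) {C D : Finset V}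
    (hC : C.Nonempty) (hCD : Disjoint C D)
    (h : ∀ c ∈ C, ∃ a ∈ D, ∃ b ∈ D, a ≠ b ∧ G.Adj c a ∧ G.Adj c b) : C.card < D.card := by
  choose! a haD b hbD hab hca hcb using h
  let n : V → Bool → V := fun c i => if i then a c else b c
  have hnD : ∀ c ∈ C, ∀ i, n c i ∈ D := by
    rintro c hc (_ | _)
    exacts [hbD c hc, haD c hc]
  have hn_adj : ∀ c ∈ C, ∀ i, G.Adj c (n c i) := by
    rintro c hc (_ | _)
    exacts [hcb c hc, hca c hc]
  have hn_inj : ∀ c ∈ C, ∀ i j, n c i = n c j → i = j := by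
    rintro c hc (_ | _) (_ | _) hij
    exacts [rfl, (hab c hc hij.symm).elim, (hab c hc hij).elim, rfl]
  let H := G.induce (↑(C ∪ D) : Set V)
  have : Nonempty (↑(C ∪ D) : Set V) := ⟨⟨hC.choose, by simp [hC.choose_spec]⟩⟩
  let φ : C × Bool → H.edgeSet := fun p =>
    ⟨s(⟨p.1, by simp⟩, ⟨n p.1 p.2, by simp [hnD p.1 p.1.2 p.2]⟩), hn_adj p.1 p.1.2 p.2⟩
  have hφ : Function.Injective φ := by
    rintro ⟨⟨c, hc⟩, i⟩ ⟨⟨d, hd⟩, j⟩ hcd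
    have hcd' := Sym2.eq_iff.1 (congrArg Subtype.val hcd)
    simp only [Subtype.mk.injEq] at hcd'
    rcases hcd' with ⟨rfl, hij⟩ | ⟨hcj, -⟩
    · rw [hn_inj c hc i j hij]
    · exact (Finset.disjoint_left.1 hCD hc (hcj ▸ hnD d hd j)).elim
  have h₁ := Fintype.card_le_of_injective φ hφ
  have h₂ := card_edgeSet_lt_of_isAcyclic (hG.induce (↑(C ∪ D) : Set V))
  have h₃ : Fintype.card (↑(C ∪ D) : Set V) = C.card + D.card := by
    rw [← Finset.card_union_of_disjoint hCD]
    simp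
  simp only [Fintype.card_prod, Fintype.card_coe, Fintype.card_bool] at h₁
  have h₄ : Fintype.card H.edgeSet < C.card + D.card := h₃ ▸ h₂
  omega

/-- In an acyclic graph the core can be matched into the support while avoiding any given vertex. -/
theorem exists_injective_core_support [Fintype V] {G : SimpleGraph V} (hG : G.IsAcyclic) (v : V) :
    ∃ f : coreSet G → V, Function.Injective f ∧
      ∀ c, f c ∈ supportSet G ∧ G.Adj c (f c) ∧ f c ≠ v := by
  let t : coreSet G → Finset V :=
    fun c => Finset.univ.filter fun s => s ∈ supportSet G ∧ G.Adj c s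
  have hHall : ∀ s : Finset (coreSet G), s.card ≤ (s.biUnion fun c => (t c).erase v).card := by
    intro s
    obtain rfl | hs := s.eq_empty_or_nonempty
    · simp
    have hlt : (s.map (Function.Embedding.subtype _)).card < (s.biUnion t).card := by
      refine card_lt_card_of_two_neighbors hG (hs.map) ?_ ?_
      · rw [Finset.disjoint_left]
        intro c hc hc'
        obtain ⟨⟨c, u, hu, huc⟩, -, rfl⟩ := Finset.mem_map.1 hc
        obtain ⟨d, -, hd⟩ := Finset.mem_biUnion.1 hc'
        exact isIndep_supportSet hG u hu c (Finset.mem_filter.1 hd).2.1 huc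
      · intro c hc
        obtain ⟨⟨c, u, hu, huc⟩, hcs, rfl⟩ := Finset.mem_map.1 hc
        obtain ⟨w, hw, huw, hcw⟩ := exists_ne_adj_mem_supportSet hu huc.symm
        refine ⟨u, Finset.mem_biUnion.2 ⟨_, hcs, ?_⟩, w, Finset.mem_biUnion.2 ⟨_, hcs, ?_⟩,
          huw, huc.symm, hcw⟩
        · exact Finset.mem_filter.2 ⟨Finset.mem_univ _, hu, huc.symm⟩
        · exact Finset.mem_filter.2 ⟨Finset.mem_univ _, hw, hcw⟩
    have hsub : (s.biUnion t).erase v ⊆ s.biUnion fun c => (t c).erase v := by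
      intro a
      simp only [Finset.mem_erase, Finset.mem_biUnion]
      tauto
    have hle := Finset.card_le_card hsub
    have hpred := Finset.pred_card_le_card_erase (s := s.biUnion t) (a := v)
    rw [Finset.card_map] at hlt
    omega
  obtain ⟨f, hf, hft⟩ := (Finset.all_card_le_biUnion_card_iff_exists_injective _).1 hHall
  refine ⟨f, hf, fun c => ?_⟩
  have := hft c
  simp only [t, Finset.mem_erase, Finset.mem_filter, Finset.mem_univ, true_and] at this
  tauto

theorem IsMatchingSet.card_le_of_cover {G : SimpleGraph V} {M : Finset (Sym2 V)}
    (hM : IsMatchingSet G M) {K : Finset V} (hK : ∀ e ∈ M, ∃ k ∈ K, k ∈ e) :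
    M.card ≤ K.card := by
  have : ∀ e : M, ∃ k : K, (k : V) ∈ (e : Sym2 V) := fun e =>
    let ⟨k, hk, hke⟩ := hK e e.2
    ⟨⟨k, hk⟩, hke⟩
  choose g hg using this
  have hinj : Function.Injective g := by
    intro e f hef
    by_contra hne
    exact hM.2 e e.2 f f.2 (fun h => hne (Subtype.ext h)) _ (hg e) (hef ▸ hg f)
  simpa using Fintype.card_le_of_injective g hinj

/-- In an acyclic graph, some matching has the size of the core and avoids a given vertex outside
the core. -/
theorem exists_isMatchingSet_card_core [Fintype V] {G : SimpleGraph V} (hG : G.IsAcyclic) (v : V) :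
    ∃ M : Finset (Sym2 V), IsMatchingSet G M ∧ M.card = (coreSet G).toFinset.card ∧
      (v ∉ coreSet G → ∀ e ∈ M, v ∉ e) := by
  obtain ⟨f, hf, hfc⟩ := exists_injective_core_support hG v
  have hne : ∀ c d : coreSet G, (c : V) ≠ f d := by
    rintro ⟨c, u, hu, huc⟩ d rfl
    exact isIndep_supportSet hG u hu _ (hfc d).1 huc
  have hmeet : ∀ (c d : coreSet G) (a : V), a ∈ s((c : V), f c) → a ∈ s((d : V), f d) → c = d := by
    intro c d a hc hd
    rcases Sym2.mem_iff.1 hc with rfl | rfl <;> rcases Sym2.mem_iff.1 hd with h | h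
    · exact Subtype.ext h
    · exact (hne c d h).elim
    · exact (hne d c h.symm).elim
    · exact hf h
  refine ⟨Finset.univ.image fun c : coreSet G => s((c : V), f c), ⟨?_, ?_⟩, ?_, ?_⟩
  · intro e he
    obtain ⟨c, -, rfl⟩ := Finset.mem_image.1 (Finset.mem_coe.1 he)
    exact (hfc c).2.1
  · intro e he e' he' hee' a ha ha'
    obtain ⟨c, -, rfl⟩ := Finset.mem_image.1 he
    obtain ⟨d, -, rfl⟩ := Finset.mem_image.1 he'
    exact hee' (by rw [hmeet c d a ha ha'])
  · rw [Finset.card_image_of_injective, Finset.card_univ, Set.toFinset_card]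
    intro c d hcd
    refine hmeet c d c (Sym2.mem_mk_left _ _) ?_
    have hcd' : s((c : V), f c) = s((d : V), f d) := hcd
    exact hcd' ▸ Sym2.mem_mk_left _ _
  · intro hv e he hve
    obtain ⟨c, -, rfl⟩ := Finset.mem_image.1 he
    rcases Sym2.mem_iff.1 hve with rfl | rfl
    · exact hv c.2
    · exact (hfc c).2.2 rfl

/-- In an S-tree, a vertex is missed by some maximum matching iff it is supported:
the Edmonds–Gallai set equals the support. -/
theorem stmt11 [Fintype V] (S : SimpleGraph V) (hS : IsSTree S) (v : V) :
    (∃ M : Finset (Sym2 V), IsMaxMatching S M ∧ ∀ e ∈ M, v ∉ e) ↔ v ∈ supportSet S := by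
  have hG := hS.1.isAcyclic
  have hV : ∀ a, a ∈ supportSet S ∨ a ∈ coreSet S := fun a =>
    (Set.ext_iff.1 hS.2 a).2 (Set.mem_univ a)
  have hcover : ∀ e ∈ S.edgeSet, ∃ k ∈ (coreSet S).toFinset, k ∈ e := by
    intro e
    induction e with
    | h a b =>
      intro hab
      rcases hV a with ha | ha
      · exact ⟨b, Set.mem_toFinset.2 ⟨a, ha, hab⟩, Sym2.mem_mk_right a b⟩
      · exact ⟨a, Set.mem_toFinset.2 ha, Sym2.mem_mk_left a b⟩
  obtain ⟨M₀, hM₀, hcard, hv₀⟩ := exists_isMatchingSet_card_core hG v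
  constructor
  · rintro ⟨M, hM, hvM⟩
    refine (hV v).resolve_right fun hv => ?_
    have hle : M.card ≤ ((coreSet S).toFinset.erase v).card := by
      refine hM.1.card_le_of_cover fun e he => ?_
      obtain ⟨k, hk, hke⟩ := hcover e (hM.1.1 he)
      exact ⟨k, Finset.mem_erase.2 ⟨fun h => hvM e he (h ▸ hke), hk⟩, hke⟩
    have hlt := Finset.card_erase_lt_of_mem (Set.mem_toFinset.2 hv)
    have := hM.2 M₀ hM₀
    omega
  · intro hv
    refine ⟨M₀, ⟨hM₀, fun M hM => ?_⟩, hv₀ ?_⟩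
    · exact hcard ▸ hM.card_le_of_cover fun e he => hcover e (hM.1 he)
    · rintro ⟨u, hu, huv⟩
      exact isIndep_supportSet hG u hu v hv huv

end NullDecomp
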